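/- Every Kakeya set K in AG(2,q) satisfies |K| ≥ q(q+1)/2. -/

import Mathlib

/-- `L` is an affine line in `AG(2,q) = F × F` with direction `d`, where the
`q+1` directions are indexed by `Option F`: `some m` is the parallel class of
lines of slope `m`, and `none` is the parallel class of vertical lines. -/
def IsLineWithDir {F : Type*} [Field F] (d : Option F) (L : Set (F × F)) : Prop :=
  match d with
  | none => ∃ c : F, L = {p : F × F | p.1 = c}
  | some m => ∃ b : F, L = {p : F × F | p.2 = m * p.1 + b}

open Classical in
theorem kakeya_aux {ι α : Type*} (q : ℕ) (A : ι → Finset α)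
    (hc : ∀ i, (A i).card = q) (hi : ∀ i j, i ≠ j → (A i ∩ A j).card ≤ 1) (S : Finset ι) :
    (S.card : ℤ) * (2 * q + 1 - S.card) ≤ 2 * ((S.biUnion A).card : ℤ) := by
  induction S using Finset.induction_on with
  | empty => simp
  | insert d S hd ih =>
    rw [Finset.card_insert_of_notMem hd, Finset.biUnion_insert]
    have h1 := Finset.card_union_add_card_inter (A d) (S.biUnion A)
    have h2 : (A d ∩ S.biUnion A).card ≤ S.card := by
      rw [Finset.inter_biUnion]
      refine Finset.card_biUnion_le.trans ?_
      calc ∑ u ∈ S, (A d ∩ A u).card ≤ ∑ u ∈ S, 1 :=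
            Finset.sum_le_sum fun u hu => hi d u (fun h => hd (h ▸ hu))
        _ = S.card := by simp
    rw [hc] at h1
    zify at h1 h2
    push_cast
    nlinarith

theorem kakeya_line_card {F : Type*} [Field F] [Fintype F] (d : Option F) (L : Set (F × F))
    (h : IsLineWithDir d L) : L.ncard = Fintype.card F := by
  rw [← Nat.card_eq_fintype_card, ← Set.ncard_univ]
  cases d with
  | none =>
    obtain ⟨c, rfl⟩ := h
    symm
    refine Set.ncard_congr (fun x _ => (c, x)) (by simp) (by simp) ?_
    rintro ⟨a, b⟩ hab
    exact ⟨b, trivial, by simpa using (show a = c from hab).symm⟩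
  | some m =>
    obtain ⟨c, rfl⟩ := h
    symm
    refine Set.ncard_congr (fun x _ => (x, m * x + c)) (by simp) (by simp) ?_
    rintro ⟨a, b⟩ hab
    exact ⟨a, trivial, by simpa using (show b = m * a + c from hab).symm⟩

theorem kakeya_line_inter {F : Type*} [Field F] (d e : Option F) (hde : d ≠ e)
    (L M : Set (F × F)) (hL : IsLineWithDir d L) (hM : IsLineWithDir e M)
    (p r : F × F) (hp : p ∈ L) (hp' : p ∈ M) (hr : r ∈ L) (hr' : r ∈ M) : p = r := by
  obtain ⟨x, y⟩ := p
  obtain ⟨z, w⟩ := r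
  cases d with
  | none =>
    cases e with
    | none => exact absurd rfl hde
    | some m =>
      obtain ⟨c, rfl⟩ := hL
      obtain ⟨b, rfl⟩ := hM
      simp only [Set.mem_ofPred_eq] at hp hp' hr hr'
      simp_all
  | some n =>
    cases e with
    | none =>
      obtain ⟨c, rfl⟩ := hL
      obtain ⟨b, rfl⟩ := hM
      simp only [Set.mem_ofPred_eq] at hp hp' hr hr'
      simp_all
    | some m =>
      obtain ⟨c, rfl⟩ := hL
      obtain ⟨b, rfl⟩ := hM
      simp only [Set.mem_ofPred_eq] at hp hp' hr hr'
      have hnm : n - m ≠ 0 := sub_ne_zero.2 fun h => hde (by rw [h])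
      have hx : x = z := by
        have : (n - m) * (x - z) = 0 := by linear_combination hp' - hp + hr - hr'
        exact sub_eq_zero.1 ((mul_eq_zero.1 this).resolve_left hnm)
      subst hx
      rw [hp, hr]

/-- Every Kakeya set `K` in `AG(2,q)` satisfies `|K| ≥ q(q+1)/2`,
i.e. `2|K| ≥ q(q+1)`. -/
theorem kakeya_lower_bound {F : Type*} [Field F] [Fintype F] (q : ℕ)
    (hq : Fintype.card F = q) (hq2 : 2 < q)
    (L : Option F → Set (F × F)) (hL : ∀ d, IsLineWithDir d (L d))
    (K : Set (F × F)) (hK : K = ⋃ d, L d) :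
    q * (q + 1) ≤ 2 * K.ncard := by
  classical
  have key := kakeya_aux q (fun d => (L d).toFinset)
    (fun d => by rw [← Set.ncard_eq_toFinset_card', kakeya_line_card d _ (hL d), hq])
    (fun i j hij => by
      rw [Finset.card_le_one]
      intro a ha b hb
      simp only [Finset.mem_inter, Set.mem_toFinset] at ha hb
      exact kakeya_line_inter i j hij _ _ (hL i) (hL j) a b ha.1 ha.2 hb.1 hb.2)
    Finset.univ
  have hU : K = ((Finset.univ.biUnion fun d => (L d).toFinset : Finset (F × F)) : Set (F × F)) := by
    rw [hK]; ext p; simp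
  rw [hU, Set.ncard_coe_finset]
  rw [Finset.card_univ, Fintype.card_option, hq] at key
  zify
  push_cast at key
  convert key using 1
  · ring
  · congr!
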